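/- Let B, a, e be as in the context, regarded as a complex matrix and complex vectors. For every z ∈ ℂ with b(z) ≠ 0, the matrix zI − B is invertible and aᵀ(zI − B)⁻¹e = a(z)/b(z). -/

import Mathlib

open Matrix

/-- The companion matrix `B` of the COGARCH(p,q) context: superdiagonal entries equal to `1`,
last row `(-β_q, -β_{q-1}, …, -β_1)` (with `β i` denoting `β_{i+1}`), all other entries `0`;
for `q = 1` this is the `1 × 1` matrix `(-β₁)`. -/
def compMat {q : ℕ} (β : Fin q → ℝ) : Matrix (Fin q) (Fin q) ℝ :=
  Matrix.of fun i j =>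
    (if (i : ℕ) + 1 = (j : ℕ) then (1 : ℝ) else 0) +
    (if (i : ℕ) = q - 1 then -β j.rev else 0)

/-- The polynomial `b(z) = z^q + β₁ z^{q-1} + ⋯ + β_q`, as a function on `ℂ`. -/
noncomputable def bFun {q : ℕ} (β : Fin q → ℝ) (z : ℂ) : ℂ :=
  z ^ q + ∑ i : Fin q, (β i : ℂ) * z ^ (q - 1 - (i : ℕ))

/-- The polynomial `a(z) = α₁ + α₂ z + ⋯ + α_p z^{p-1}`, as a function on `ℂ`. -/
noncomputable def aFun {p q : ℕ} (hpq : p ≤ q) (α : Fin q → ℝ) (z : ℂ) : ℂ :=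
  ∑ i : Fin p, (α (Fin.castLE hpq i) : ℂ) * z ^ (i : ℕ)

/-- The action of `z I - B` on a vector, row by row. -/
theorem smul_one_sub_compMat_mulVec {q : ℕ} (β : Fin q → ℝ) (z : ℂ) (w : Fin q → ℂ) (i : Fin q) :
    ((z • (1 : Matrix (Fin q) (Fin q) ℂ) - (compMat β).map Complex.ofReal) *ᵥ w) i =
      z * w i - (∑ j : Fin q, if (i : ℕ) + 1 = (j : ℕ) then w j else 0) +
        if (i : ℕ) = q - 1 then ∑ j : Fin q, (β j.rev : ℂ) * w j else 0 := by
  rw [Matrix.sub_mulVec, Matrix.smul_mulVec, Matrix.one_mulVec, Pi.sub_apply, Pi.smul_apply,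
    smul_eq_mul, sub_add]
  congr 1
  have key : ∀ j : Fin q, ((compMat β).map Complex.ofReal) i j * w j =
      (if (i : ℕ) + 1 = (j : ℕ) then w j else 0) -
        (if (i : ℕ) = q - 1 then (β j.rev : ℂ) * w j else 0) := by
    intro j
    simp only [compMat, Matrix.map_apply, Matrix.of_apply]
    split_ifs <;> push_cast <;> ring
  simp only [Matrix.mulVec, dotProduct, key, Finset.sum_sub_distrib]
  split_ifs <;> simp

theorem smul_one_sub_compMat_mulVec_of_lt {q : ℕ} (β : Fin q → ℝ) (z : ℂ) (w : Fin q → ℂ)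
    (i : ℕ) (hi : i + 1 < q) :
    ((z • (1 : Matrix (Fin q) (Fin q) ℂ) - (compMat β).map Complex.ofReal) *ᵥ w)
        ⟨i, Nat.lt_of_succ_lt hi⟩ =
      z * w ⟨i, Nat.lt_of_succ_lt hi⟩ - w ⟨i + 1, hi⟩ := by
  rw [smul_one_sub_compMat_mulVec, if_neg (by simp only; omega), add_zero]
  congr 1
  rw [Finset.sum_eq_single ⟨i + 1, hi⟩]
  · simp
  · intro j _ hj
    exact if_neg fun h => hj (Fin.ext h.symm)
  · simp

theorem smul_one_sub_compMat_mulVec_last {q : ℕ} (β : Fin q → ℝ) (z : ℂ) (w : Fin q → ℂ)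
    (i : Fin q) (hi : (i : ℕ) = q - 1) :
    ((z • (1 : Matrix (Fin q) (Fin q) ℂ) - (compMat β).map Complex.ofReal) *ᵥ w) i =
      z * w i + ∑ j : Fin q, (β j.rev : ℂ) * w j := by
  rw [smul_one_sub_compMat_mulVec, if_pos hi, Finset.sum_eq_zero, sub_zero]
  intro j _
  exact if_neg (by omega)

/-- The vector `(1, z, …, z^{q-1})` is mapped by `z I - B` to `b(z) e`. -/
theorem smul_one_sub_compMat_mulVec_pow {q : ℕ} (β : Fin q → ℝ) (z : ℂ) :
    ((z • (1 : Matrix (Fin q) (Fin q) ℂ) - (compMat β).map Complex.ofReal) *ᵥ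
        fun j => z ^ (j : ℕ)) =
      bFun β z • fun j : Fin q => if (j : ℕ) = q - 1 then (1 : ℂ) else 0 := by
  funext i
  by_cases hi : (i : ℕ) = q - 1
  · rw [smul_one_sub_compMat_mulVec_last β z _ i hi]
    simp only [Pi.smul_apply, smul_eq_mul, if_pos hi, mul_one, bFun]
    congr 1
    · rw [← pow_succ']
      congr 1
      omega
    · refine Fintype.sum_equiv Fin.revPerm _ _ fun j => ?_
      simp only [Fin.revPerm_apply, Fin.val_rev]
      congr 2
      omega
  · have hlt : (i : ℕ) + 1 < q := by omega
    have h := smul_one_sub_compMat_mulVec_of_lt β z (fun j => z ^ (j : ℕ)) i hlt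
    simp only [Fin.eta] at h
    rw [h]
    simp only [Pi.smul_apply, smul_eq_mul, if_neg hi]
    ring

theorem isUnit_smul_one_sub_compMat {q : ℕ} (β : Fin q → ℝ) (z : ℂ) (hz : bFun β z ≠ 0) :
    IsUnit (z • (1 : Matrix (Fin q) (Fin q) ℂ) - (compMat β).map Complex.ofReal) := by
  rw [← Matrix.mulVec_injective_iff_isUnit, ← Matrix.coe_mulVecLin,
    ← LinearMap.ker_eq_bot, LinearMap.ker_eq_bot']
  intro w hw
  rw [Matrix.mulVecLin_apply] at hw
  rcases Nat.eq_zero_or_pos q with rfl | hq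
  · exact Subsingleton.elim _ _
  have hpow : ∀ (i : ℕ) (hi : i < q), w ⟨i, hi⟩ = w ⟨0, hq⟩ * z ^ i := by
    intro i
    induction i with
    | zero => simp
    | succ i ih =>
      intro hi
      have h := smul_one_sub_compMat_mulVec_of_lt β z w i hi
      rw [hw, Pi.zero_apply, ih] at h
      rw [pow_succ]
      linear_combination h
  have hvec : w = w ⟨0, hq⟩ • fun j : Fin q => z ^ (j : ℕ) :=
    funext fun i => hpow i i.isLt
  have h0 : w ⟨0, hq⟩ = 0 := by
    rw [hvec, Matrix.mulVec_smul, smul_one_sub_compMat_mulVec_pow] at hw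
    have h := congrFun hw ⟨q - 1, by omega⟩
    simpa [hz] using h
  rw [hvec, h0, zero_smul]

/-- For every `z ∈ ℂ` with `b(z) ≠ 0`, the matrix `z I - B` is invertible and
`aᵀ (z I - B)⁻¹ e = a(z) / b(z)`. -/
theorem stmt6 {p q : ℕ} (hp : 1 ≤ p) (hpq : p ≤ q)
    (α : Fin q → ℝ) (β : Fin q → ℝ)
    (hαp : α ⟨p - 1, by omega⟩ ≠ 0)
    (hα0 : ∀ j : Fin q, p ≤ (j : ℕ) → α j = 0)
    (hβq : β ⟨q - 1, by omega⟩ ≠ 0) :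
    ∀ z : ℂ, bFun β z ≠ 0 →
      IsUnit (z • (1 : Matrix (Fin q) (Fin q) ℂ) - (compMat β).map Complex.ofReal) ∧
      (fun j : Fin q => (α j : ℂ)) ⬝ᵥ
          ((z • (1 : Matrix (Fin q) (Fin q) ℂ) - (compMat β).map Complex.ofReal)⁻¹ *ᵥ
            fun j : Fin q => if (j : ℕ) = q - 1 then (1 : ℂ) else 0)
        = aFun hpq α z / bFun β z := by
  intro z hz
  have hU := isUnit_smul_one_sub_compMat β z hz
  refine ⟨hU, ?_⟩
  have hinv := congrArg
    (fun v => (z • (1 : Matrix (Fin q) (Fin q) ℂ) - (compMat β).map Complex.ofReal)⁻¹ *ᵥ v)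
    (smul_one_sub_compMat_mulVec_pow β z)
  simp only [Matrix.mulVec_mulVec, Matrix.mulVec_smul] at hinv
  rw [Matrix.nonsing_inv_mul _ ((Matrix.isUnit_iff_isUnit_det _).mp hU),
    Matrix.one_mulVec] at hinv
  rw [eq_div_iff hz, mul_comm, ← smul_eq_mul, ← dotProduct_smul, ← hinv]
  simp only [dotProduct, aFun]
  symm
  refine Finset.sum_of_injOn (Fin.castLE hpq) (Fin.castLE_injective hpq).injOn
    (by simp) ?_ (by simp)
  intro j _ hj
  rw [hα0 j, Complex.ofReal_zero, zero_mul]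
  by_contra! hlt
  exact hj ⟨⟨j, hlt⟩, by simp, rfl⟩
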